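/- Let (A_n) be an asymptotically regular sequence of symmetric matrices, let q = 2, J = β·I_2 with β ≥ 0, and h ∈ ℝ² with B := h(1) − h(2) ≠ 0, and let μ_n be the corresponding Potts (Ising) measure on {1,2}^n. Let m ∈ (−1,1) satisfy m = tanh((β/2)·m + B/2) and m·B > 0 (such m exists and is unique). Then for every δ > 0 there exists ε > 0 such that for all sufficiently large n, μ_n({y : (1/n)·Σ_{i=1}^n (1{y_i=1} − 1{y_i=2}) ∈ [m−δ, m+δ]}) ≥ 1 − e^{−n·ε}. -/

import Mathlib

open Finset Filter Real

noncomputable def pottsH {n q : ℕ} (A : Matrix (Fin n) (Fin n) ℝ)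
    (J : Matrix (Fin q) (Fin q) ℝ) (h : Fin q → ℝ) (y : Fin n → Fin q) : ℝ :=
  (1 / 2) * ∑ i, ∑ j, A i j * J (y i) (y j) + ∑ i, h (y i)

noncomputable def pottsPhi {n q : ℕ} (A : Matrix (Fin n) (Fin n) ℝ)
    (J : Matrix (Fin q) (Fin q) ℝ) (h : Fin q → ℝ) : ℝ :=
  Real.log (∑ y : Fin n → Fin q, Real.exp (pottsH A J h y))

open scoped Classical in
/-- Mass that the Potts measure `μ_n(y) = exp(H(y) - Φ)` assigns to a set of configurations. -/
noncomputable def pottsMass {n q : ℕ} (A : Matrix (Fin n) (Fin n) ℝ)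
    (J : Matrix (Fin q) (Fin q) ℝ) (h : Fin q → ℝ) (S : Set (Fin n → Fin q)) : ℝ :=
  ∑ y ∈ Finset.univ.filter (fun y => y ∈ S), Real.exp (pottsH A J h y - pottsPhi A J h)

def meanFieldAssumption (A : (n : ℕ) → Matrix (Fin n) (Fin n) ℝ) : Prop :=
  (∃ C : ℝ, ∀ n : ℕ, ∀ x : Fin n → ℝ, (∀ j, x j ∈ Set.Icc (0:ℝ) 1) →
      ∑ i, |∑ j, A n i j * x j| ≤ C * n) ∧
  Tendsto (fun n : ℕ => Matrix.trace (A n * A n) / n) atTop (nhds 0)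

open scoped Classical in
def asympRegular (A : (n : ℕ) → Matrix (Fin n) (Fin n) ℝ) : Prop :=
  meanFieldAssumption A ∧
  (∀ n : ℕ, ∀ i j : Fin n, 0 ≤ A n i j) ∧
  (∀ δ : ℝ, 0 < δ →
    Tendsto (fun n : ℕ =>
        ((Finset.univ.filter (fun i : Fin n => δ < |(∑ j, A n i j) - 1|)).card : ℝ) / n)
      atTop (nhds 0)) ∧
  Tendsto (fun n : ℕ => (∑ i, ∑ j, A n i j) / n) atTop (nhds 1)

/-- Average magnetization: spin values `0 : Fin 2` (color 1) and `1 : Fin 2` (color 2). -/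
noncomputable def avgMagnet {n : ℕ} (y : Fin n → Fin 2) : ℝ :=
  (1 / (n : ℝ)) *
    ∑ i, ((if y i = 0 then (1 : ℝ) else 0) - (if y i = 1 then (1 : ℝ) else 0))


/-! ### The mean-field variational functional -/

/-- The mean-field functional `c s² + b s + H((1+s)/2)`, with `H` the binary entropy. -/
noncomputable def meanFieldFunctional (c b s : ℝ) : ℝ :=
  c * s ^ 2 + b * s + Real.binEntropy ((1 + s) / 2)

lemma continuous_meanFieldFunctional (c b : ℝ) : Continuous (meanFieldFunctional c b) := by
  unfold meanFieldFunctional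
  fun_prop

lemma meanFieldFunctional_neg (c b s : ℝ) :
    meanFieldFunctional c (-b) (-s) = meanFieldFunctional c b s := by
  unfold meanFieldFunctional
  rw [← Real.binEntropy_one_sub ((1 + s) / 2)]
  ring_nf

lemma log_one_add_tanh_sub_log_one_sub_tanh (w : ℝ) :
    Real.log (1 + Real.tanh w) - Real.log (1 - Real.tanh w) = 2 * w := by
  have h1 := Real.exp_pos w
  have h2 := Real.exp_pos (-w)
  have e1 : 1 + Real.tanh w = 2 * Real.exp w / (Real.exp w + Real.exp (-w)) := by
    rw [Real.tanh_eq]; field_simp; ring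
  have e2 : 1 - Real.tanh w = 2 * Real.exp (-w) / (Real.exp w + Real.exp (-w)) := by
    rw [Real.tanh_eq]; field_simp; ring
  rw [e1, e2, Real.log_div (by positivity) (by positivity),
    Real.log_div (by positivity) (by positivity), Real.log_mul (by norm_num) (by positivity),
    Real.log_mul (by norm_num) (by positivity), Real.log_exp, Real.log_exp]
  ring

lemma concaveOn_log_one_sub_sub_log_one_add :
    ConcaveOn ℝ (Set.Ico (0 : ℝ) 1) fun s => Real.log (1 - s) - Real.log (1 + s) := by
  have hd : ∀ s ∈ Set.Ico (0 : ℝ) 1,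
      HasDerivAt (fun s => Real.log (1 - s) - Real.log (1 + s)) (-2 / (1 - s ^ 2)) s := by
    rintro s ⟨h0, h1⟩
    have h2 : (1 - s) ≠ 0 := by linarith
    have h3 : (1 + s) ≠ 0 := by linarith
    have h4 : (1 - s ^ 2) ≠ 0 := by nlinarith
    have := (((hasDerivAt_id s).const_sub 1).log h2).sub (((hasDerivAt_id s).const_add 1).log h3)
    refine this.congr_deriv ?_
    simp only [id]
    rw [div_sub_div _ _ h2 h3, div_eq_div_iff (mul_ne_zero h2 h3) h4]
    ring
  refine AntitoneOn.concaveOn_of_deriv (convex_Ico 0 1)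
    (fun s hs => (hd s hs).continuousAt.continuousWithinAt)
    (fun s hs => (hd s (interior_subset hs)).differentiableAt.differentiableWithinAt) ?_
  intro s hs t ht hst
  have hs' := interior_subset hs
  have ht' := interior_subset ht
  rw [(hd s hs').deriv, (hd t ht').deriv]
  have h1 : 0 < 1 - t ^ 2 := by nlinarith [ht'.1, ht'.2]
  have h2 : 1 - t ^ 2 ≤ 1 - s ^ 2 := by nlinarith [hs'.1]
  rw [neg_div, neg_div, neg_le_neg_iff]
  gcongr

lemma hasDerivAt_meanFieldFunctional (c b : ℝ) {s : ℝ} (h0 : -1 < s) (h1 : s < 1) :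
    HasDerivAt (meanFieldFunctional c b)
      (2 * c * s + b + (Real.log (1 - s) - Real.log (1 + s)) / 2) s := by
  have hb := Real.hasDerivAt_binEntropy (p := (1 + s) / 2) (by linarith) (by linarith)
  have hl : HasDerivAt (fun s : ℝ => (1 + s) / 2) (1 / 2) s :=
    ((hasDerivAt_id s).const_add 1).div_const 2
  have := ((((hasDerivAt_id s).pow 2).const_mul c).add ((hasDerivAt_id s).const_mul b)).add
    (hb.comp s hl)
  refine this.congr_deriv ?_
  have e : 1 - (1 + s) / 2 = (1 - s) / 2 := by ring
  rw [e, Real.log_div (by linarith) (by norm_num), Real.log_div (by linarith) (by norm_num)]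
  simp only [id]
  push_cast
  ring

lemma meanFieldFunctional_lt_of_pos {c b m s : ℝ} (hb : 0 < b) (hm0 : 0 < m)
    (hm1 : m < 1) (hfix : m = Real.tanh (2 * c * m + b)) (hs : s ∈ Set.Icc (-1 : ℝ) 1)
    (hsm : s ≠ m) : meanFieldFunctional c b s < meanFieldFunctional c b m := by
  set g : ℝ → ℝ := fun s => 2 * c * s + b + (Real.log (1 - s) - Real.log (1 + s)) / 2 with hg
  have hgm : g m = 0 := by
    have := log_one_add_tanh_sub_log_one_sub_tanh (2 * c * m + b)
    rw [← hfix] at this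
    simp only [hg]
    linarith
  have hconc := concaveOn_log_one_sub_sub_log_one_add
  have hg0 : g 0 = b := by simp [hg]
  have hconv : ∀ u ∈ Set.Ico (0 : ℝ) 1, ∀ r ∈ Set.Icc (0 : ℝ) 1,
      r * g u + (1 - r) * b ≤ g (r * u) := by
    intro u hu r hr
    have := hconc.2 hu (Set.left_mem_Ico.2 one_pos) hr.1 (sub_nonneg.2 hr.2) (by ring)
    simp only [smul_eq_mul, sub_zero, add_zero, Real.log_one, mul_zero] at this
    simp only [hg]
    linarith
  have hmono : StrictMonoOn (meanFieldFunctional c b) (Set.Icc 0 m) := by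
    refine strictMonoOn_of_deriv_pos (convex_Icc _ _)
      (continuous_meanFieldFunctional c b).continuousOn fun u hu => ?_
    rw [interior_Icc] at hu
    rw [(hasDerivAt_meanFieldFunctional c b (by linarith [hu.1]) (by linarith [hu.2])).deriv]
    have h1 : u / m < 1 := (div_lt_one hm0).2 hu.2
    have := hconv m ⟨hm0.le, hm1⟩ (u / m) ⟨div_nonneg hu.1.le hm0.le, h1.le⟩
    rw [hgm, div_mul_cancel₀ _ hm0.ne'] at this
    have : 0 < (1 - u / m) * b := mul_pos (by linarith) hb
    change 0 < g u
    linarith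
  have hanti : StrictAntiOn (meanFieldFunctional c b) (Set.Icc m 1) := by
    refine strictAntiOn_of_deriv_neg (convex_Icc _ _)
      (continuous_meanFieldFunctional c b).continuousOn fun u hu => ?_
    rw [interior_Icc] at hu
    rw [(hasDerivAt_meanFieldFunctional c b (by linarith [hu.1]) (by linarith [hu.2])).deriv]
    have hu0 : 0 < u := hm0.trans hu.1
    have h1 : m / u < 1 := (div_lt_one hu0).2 hu.1
    have h2 : 0 < m / u := div_pos hm0 hu0
    have := hconv u ⟨hu0.le, hu.2⟩ (m / u) ⟨h2.le, h1.le⟩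
    rw [div_mul_cancel₀ _ hu0.ne', hgm] at this
    have h3 : 0 < (1 - m / u) * b := mul_pos (by linarith) hb
    change g u < 0
    by_contra hcon
    have := mul_nonneg h2.le (not_lt.1 hcon)
    linarith
  have hnonneg : ∀ u ∈ Set.Icc (0 : ℝ) 1, meanFieldFunctional c b u ≤ meanFieldFunctional c b m ∧
      (u ≠ m → meanFieldFunctional c b u < meanFieldFunctional c b m) := by
    intro u hu
    rcases lt_trichotomy u m with h | h | h
    · have := hmono ⟨hu.1, h.le⟩ ⟨hm0.le, le_rfl⟩ h
      exact ⟨this.le, fun _ => this⟩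
    · exact ⟨h ▸ le_rfl, fun h' => absurd h h'⟩
    · have := hanti ⟨le_rfl, hm1.le⟩ ⟨h.le, hu.2⟩ h
      exact ⟨this.le, fun _ => this⟩
  rcases le_or_gt 0 s with h | h
  · exact (hnonneg s ⟨h, hs.2⟩).2 hsm
  · refine lt_of_lt_of_le ?_ (hnonneg (-s) ⟨by linarith, by linarith [hs.1]⟩).1
    rw [← meanFieldFunctional_neg c b s]
    unfold meanFieldFunctional
    nlinarith

lemma meanFieldFunctional_lt {c b m s : ℝ} (hmb : 0 < m * b) (hm : m ∈ Set.Ioo (-1 : ℝ) 1)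
    (hfix : m = Real.tanh (2 * c * m + b)) (hs : s ∈ Set.Icc (-1 : ℝ) 1)
    (hsm : s ≠ m) : meanFieldFunctional c b s < meanFieldFunctional c b m := by
  rcases pos_and_pos_or_neg_and_neg_of_mul_pos hmb with ⟨h1, h2⟩ | ⟨h1, h2⟩
  · exact meanFieldFunctional_lt_of_pos h2 h1 hm.2 hfix hs hsm
  · rw [← meanFieldFunctional_neg c b s, ← meanFieldFunctional_neg c b m]
    refine meanFieldFunctional_lt_of_pos (by linarith) (by linarith) (by linarith [hm.1]) ?_
      ⟨by linarith [hs.2], by linarith [hs.1]⟩ (fun h => hsm (neg_injective h))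
    rw [show 2 * c * -m + -b = -(2 * c * m + b) by ring, Real.tanh_neg, ← hfix]

/-- Stability of the maximum under small perturbations of the coefficients. -/
lemma exists_meanFieldFunctional_perturbation {c b m δ : ℝ} (hδ : 0 < δ)
    (hmax : ∀ s ∈ Set.Icc (-1 : ℝ) 1, s ≠ m →
      meanFieldFunctional c b s < meanFieldFunctional c b m) (hm : m ∈ Set.Ioo (-1 : ℝ) 1) :
    ∃ t > 0, ∃ γ > c, ∀ τ, |τ| = t → ∀ s ∈ Set.Icc (-1 : ℝ) 1,
      meanFieldFunctional γ (b + τ) s ≤ meanFieldFunctional c b m + τ * m + t * (δ / 2) := by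
  obtain ⟨κ, hκ, hgap⟩ : ∃ κ > 0, ∀ s ∈ Set.Icc (-1 : ℝ) 1, δ / 4 ≤ |s - m| →
      meanFieldFunctional c b s + κ ≤ meanFieldFunctional c b m := by
    have hcomp : IsCompact (Set.Icc (-1 : ℝ) 1 ∩ {s | δ / 4 ≤ |s - m|}) :=
      isCompact_Icc.inter_right (isClosed_le continuous_const (by fun_prop))
    rcases (Set.Icc (-1 : ℝ) 1 ∩ {s | δ / 4 ≤ |s - m|}).eq_empty_or_nonempty with h | h
    · refine ⟨1, one_pos, fun s hs hsm => ?_⟩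
      exact absurd h (Set.Nonempty.ne_empty ⟨s, hs, hsm⟩)
    · obtain ⟨s₀, hs₀, hs₀'⟩ := hcomp.exists_isMaxOn h
        (continuous_meanFieldFunctional c b).continuousOn
      have hne : s₀ ≠ m := by
        rintro rfl
        have : δ / 4 ≤ |s₀ - s₀| := hs₀.2
        rw [sub_self, abs_zero] at this
        linarith
      have h1 := hmax s₀ hs₀.1 hne
      refine ⟨meanFieldFunctional c b m - meanFieldFunctional c b s₀, by linarith,
        fun s hs hsm => ?_⟩
      have : meanFieldFunctional c b s ≤ meanFieldFunctional c b s₀ := hs₀' ⟨hs, hsm⟩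
      linarith
  have hle : ∀ s ∈ Set.Icc (-1 : ℝ) 1,
      meanFieldFunctional c b s ≤ meanFieldFunctional c b m := by
    intro s hs
    rcases eq_or_ne s m with rfl | h
    · exact le_rfl
    · exact (hmax s hs h).le
  refine ⟨κ / 2, by positivity, c + κ * δ / 8, ?_, ?_⟩
  · have : 0 < κ * δ / 8 := by positivity
    linarith
  · intro τ hτ s hs
    have hexp : meanFieldFunctional (c + κ * δ / 8) (b + τ) s
        = meanFieldFunctional c b s + κ * δ / 8 * s ^ 2 + τ * m + τ * (s - m) := by
      unfold meanFieldFunctional; ring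
    have hs2 : s ^ 2 ≤ 1 := by nlinarith [hs.1, hs.2]
    have h1 : κ * δ / 8 * s ^ 2 ≤ κ * δ / 8 := by
      have : 0 < κ * δ / 8 := by positivity
      nlinarith
    have h2 : τ * (s - m) ≤ κ / 2 * |s - m| := by
      rw [← hτ, ← abs_mul]; exact le_abs_self _
    rw [hexp]
    rcases le_or_gt (δ / 4) |s - m| with h | h
    · have := hgap s hs h
      have h3 : |s - m| ≤ 2 := by
        rw [abs_le]; constructor <;> linarith [hs.1, hs.2, hm.1, hm.2]
      nlinarith
    · have := hle s hs
      nlinarith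

/-- The Gibbs variational principle for a single spin, in the form of an upper bound. -/
lemma exists_exp_add_exp_neg_le (v : ℝ) : ∃ s ∈ Set.Icc (-1 : ℝ) 1,
    Real.exp v + Real.exp (-v) ≤ Real.exp (v * s + Real.binEntropy ((1 + s) / 2)) := by
  have h1 := Real.exp_pos v
  have h2 := Real.exp_pos (-v)
  refine ⟨Real.tanh v, ⟨(Real.neg_one_lt_tanh v).le, (Real.tanh_lt_one v).le⟩, le_of_eq ?_⟩
  have e1 : (1 + Real.tanh v) / 2 = Real.exp v / (Real.exp v + Real.exp (-v)) := by
    rw [Real.tanh_eq]; field_simp; ring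
  have e2 : 1 - (1 + Real.tanh v) / 2 = Real.exp (-v) / (Real.exp v + Real.exp (-v)) := by
    rw [Real.tanh_eq]; field_simp; ring
  rw [Real.binEntropy, e2, e1, Real.log_inv, Real.log_inv, Real.log_div (by positivity)
    (by positivity), Real.log_div (by positivity) (by positivity), Real.log_exp, Real.log_exp]
  have : v * Real.tanh v + (Real.exp v / (Real.exp v + Real.exp (-v)) *
      -(v - Real.log (Real.exp v + Real.exp (-v))) +
      Real.exp (-v) / (Real.exp v + Real.exp (-v)) *
        -(-v - Real.log (Real.exp v + Real.exp (-v)))) =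
      Real.log (Real.exp v + Real.exp (-v)) := by
    rw [Real.tanh_eq]; field_simp; ring
  rw [this, Real.exp_log (by positivity)]

/-! ### Ising sums -/

/-- The spin `±1` attached to a color. -/
def isingSpin (a : Fin 2) : ℝ := (if a = 0 then (1 : ℝ) else 0) - (if a = 1 then (1 : ℝ) else 0)

@[simp] lemma isingSpin_zero : isingSpin 0 = 1 := by simp [isingSpin]

@[simp] lemma isingSpin_one : isingSpin 1 = -1 := by simp [isingSpin]

lemma isingSpin_sq (a : Fin 2) : isingSpin a ^ 2 = 1 := by
  fin_cases a <;> simp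

lemma abs_isingSpin (a : Fin 2) : |isingSpin a| = 1 := by
  fin_cases a <;> simp

/-- The Ising energy with coupling `c` and field `b`. -/
noncomputable def isingEnergy {n : ℕ} (A : Matrix (Fin n) (Fin n) ℝ) (c b : ℝ)
    (y : Fin n → Fin 2) : ℝ :=
  c * ∑ i, ∑ j, A i j * (isingSpin (y i) * isingSpin (y j)) + b * ∑ i, isingSpin (y i)

/-- The Ising partition function. -/
noncomputable def isingZ {n : ℕ} (A : Matrix (Fin n) (Fin n) ℝ) (c b : ℝ) : ℝ :=
  ∑ y : Fin n → Fin 2, Real.exp (isingEnergy A c b y)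

lemma isingZ_pos {n : ℕ} (A : Matrix (Fin n) (Fin n) ℝ) (c b : ℝ) : 0 < isingZ A c b :=
  Finset.sum_pos (fun _ _ => Real.exp_pos _) Finset.univ_nonempty

lemma pottsH_eq_isingEnergy {n : ℕ} (A : Matrix (Fin n) (Fin n) ℝ) (β : ℝ) (h : Fin 2 → ℝ)
    (y : Fin n → Fin 2) :
    pottsH A (β • (1 : Matrix (Fin 2) (Fin 2) ℝ)) h y =
      isingEnergy A (β / 4) ((h 0 - h 1) / 2) y +
        (β / 4 * ∑ i, ∑ j, A i j + n * ((h 0 + h 1) / 2)) := by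
  have h1 : ∀ a b : Fin 2, (β • (1 : Matrix (Fin 2) (Fin 2) ℝ)) a b =
      β / 2 * (1 + isingSpin a * isingSpin b) := by
    intro a b
    fin_cases a <;> fin_cases b <;> norm_num
  have h2 : ∀ a : Fin 2, h a = (h 0 + h 1) / 2 + (h 0 - h 1) / 2 * isingSpin a := by
    intro a
    fin_cases a <;> simp <;> ring
  unfold pottsH isingEnergy
  have e1 : ∑ i, ∑ j, A i j * (β • (1 : Matrix (Fin 2) (Fin 2) ℝ)) (y i) (y j) =
      β / 2 * ∑ i, ∑ j, A i j +
        β / 2 * ∑ i, ∑ j, A i j * (isingSpin (y i) * isingSpin (y j)) := by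
    simp only [h1, Finset.mul_sum, ← Finset.sum_add_distrib]
    exact Finset.sum_congr rfl fun i _ => Finset.sum_congr rfl fun j _ => by ring
  have e2 : ∑ i, h (y i) = n * ((h 0 + h 1) / 2) + (h 0 - h 1) / 2 * ∑ i, isingSpin (y i) := by
    rw [Finset.sum_congr rfl fun i _ => h2 (y i), Finset.sum_add_distrib, Finset.mul_sum]
    simp
  rw [e1, e2]
  ring

open scoped Classical in
lemma pottsMass_eq_ising {n : ℕ} (A : Matrix (Fin n) (Fin n) ℝ) (β : ℝ) (h : Fin 2 → ℝ)
    (S : Set (Fin n → Fin 2)) :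
    pottsMass A (β • (1 : Matrix (Fin 2) (Fin 2) ℝ)) h S =
      1 - (∑ y ∈ Finset.univ.filter (fun y => y ∉ S),
        Real.exp (isingEnergy A (β / 4) ((h 0 - h 1) / 2) y)) /
          isingZ A (β / 4) ((h 0 - h 1) / 2) := by
  have hZ := isingZ_pos A (β / 4) ((h 0 - h 1) / 2)
  unfold pottsMass pottsPhi
  simp only [pottsH_eq_isingEnergy]
  set K := β / 4 * ∑ i, ∑ j, A i j + n * ((h 0 + h 1) / 2)
  have e : Real.log (∑ y, Real.exp (isingEnergy A (β / 4) ((h 0 - h 1) / 2) y + K)) =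
      Real.log (isingZ A (β / 4) ((h 0 - h 1) / 2)) + K := by
    simp only [Real.exp_add, ← Finset.sum_mul]
    rw [Real.log_mul (by exact hZ.ne') (Real.exp_pos K).ne', Real.log_exp]
    rfl
  rw [e]
  simp only [add_sub_add_right_eq_sub, Real.exp_sub, Real.exp_log hZ, ← Finset.sum_div]
  rw [eq_sub_iff_add_eq, ← add_div, div_eq_one_iff_eq hZ.ne',
    Finset.sum_filter_add_sum_filter_not]
  rfl

/-! ### Lower bound for the partition function -/

lemma sum_prod_weight_mul_mul {ι κ : Type*} [Fintype ι] [DecidableEq ι] [Fintype κ]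
    {w : κ → ℝ} (hw : ∑ a, w a = 1) (f g : κ → ℝ) {i j : ι} (hij : i ≠ j) :
    ∑ y : ι → κ, (∏ k, w (y k)) * (f (y i) * g (y j)) =
      (∑ a, w a * f a) * ∑ a, w a * g a := by
  have h1 : ∀ y : ι → κ, (∏ k, w (y k)) * (f (y i) * g (y j)) =
      ∏ k, w (y k) * ((if k = i then f (y k) else 1) * if k = j then g (y k) else 1) := by
    intro y
    simp only [Finset.prod_mul_distrib, Finset.prod_ite_eq', Finset.mem_univ, if_true]
  rw [Finset.sum_congr rfl fun y _ => h1 y, ← Fintype.prod_sum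
    (fun k a => w a * ((if k = i then f a else 1) * if k = j then g a else 1))]
  have h2 : ∀ k, ∑ a, w a * ((if k = i then f a else 1) * if k = j then g a else 1) =
      (if k = i then ∑ a, w a * f a else 1) * if k = j then ∑ a, w a * g a else 1 := by
    intro k
    by_cases hi : k = i
    · have hj : k ≠ j := fun h => hij (hi ▸ h)
      simp [hi, hij]
    · by_cases hj : k = j
      · simp [hj, hij.symm]
      · simp [hi, hj, hw]
  rw [Finset.prod_congr rfl fun k _ => h2 k]
  simp only [Finset.prod_mul_distrib, Finset.prod_ite_eq', Finset.mem_univ, if_true]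

lemma sum_prod_weight_mul {ι κ : Type*} [Fintype ι] [DecidableEq ι] [Fintype κ]
    {w : κ → ℝ} (hw : ∑ a, w a = 1) (f : κ → ℝ) (i : ι) :
    ∑ y : ι → κ, (∏ k, w (y k)) * f (y i) = ∑ a, w a * f a := by
  have h1 : ∀ y : ι → κ, (∏ k, w (y k)) * f (y i) =
      ∏ k, w (y k) * (if k = i then f (y k) else 1) := by
    intro y
    simp only [Finset.prod_mul_distrib, Finset.prod_ite_eq', Finset.mem_univ, if_true]
  rw [Finset.sum_congr rfl fun y _ => h1 y, ← Fintype.prod_sum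
    (fun k a => w a * (if k = i then f a else 1))]
  have h2 : ∀ k, ∑ a, w a * (if k = i then f a else 1) =
      if k = i then ∑ a, w a * f a else 1 := by
    intro k
    by_cases hi : k = i <;> simp [hi, hw]
  rw [Finset.prod_congr rfl fun k _ => h2 k]
  simp

lemma exp_meanField_le_isingZ {n : ℕ} {A : Matrix (Fin n) (Fin n) ℝ} (hA : ∀ i j, 0 ≤ A i j)
    {c b m : ℝ} (hc : 0 ≤ c) (hm : m ∈ Set.Ioo (-1 : ℝ) 1) :
    Real.exp (c * m ^ 2 * (∑ i, ∑ j, A i j) +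
      n * (b * m + Real.binEntropy ((1 + m) / 2))) ≤ isingZ A c b := by
  set w : Fin 2 → ℝ := fun a => (1 + m * isingSpin a) / 2 with hw
  have hw0 : ∀ a, 0 < w a := by
    intro a
    fin_cases a <;> simp [hw] <;> linarith [hm.1, hm.2]
  have hw1 : ∑ a, w a = 1 := by simp [hw]; ring
  set ν : (Fin n → Fin 2) → ℝ := fun y => ∏ k, w (y k) with hν
  have hν0 : ∀ y, 0 < ν y := fun y => Finset.prod_pos fun k _ => hw0 _
  have hν1 : ∑ y, ν y = 1 := by
    rw [hν, ← Fintype.prod_sum (fun _ a => w a)]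
    simp [hw1]
  have hjensen := convexOn_exp.map_sum_le (t := Finset.univ) (w := ν)
    (p := fun y => isingEnergy A c b y - Real.log (ν y)) (fun y _ => (hν0 y).le) hν1
    (fun _ _ => Set.mem_univ _)
  have hZ : ∑ y, ν y • Real.exp (isingEnergy A c b y - Real.log (ν y)) = isingZ A c b := by
    refine Finset.sum_congr rfl fun y _ => ?_
    rw [Real.exp_sub, Real.exp_log (hν0 y), smul_eq_mul, mul_div_cancel₀ _ (hν0 y).ne']
  rw [hZ] at hjensen
  refine le_trans (Real.exp_le_exp.2 ?_) hjensen
  have hlog : ∀ y, Real.log (ν y) = ∑ i, Real.log (w (y i)) := fun y =>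
    Real.log_prod fun i _ => (hw0 _).ne'
  have hmean : ∑ a, w a * isingSpin a = m := by simp [hw]; ring
  have hent : ∑ a, w a * (b * isingSpin a - Real.log (w a)) =
      b * m + Real.binEntropy ((1 + m) / 2) := by
    have : 1 - (1 + m) / 2 = (1 + -m) / 2 := by ring
    simp only [hw, Fin.sum_univ_two, isingSpin_zero, isingSpin_one, Real.binEntropy, this,
      Real.log_inv]
    ring_nf
  have hcov : ∀ i j, m ^ 2 ≤ ∑ y, ν y * (isingSpin (y i) * isingSpin (y j)) := by
    intro i j
    by_cases hij : i = j
    · subst hij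
      simp only [← sq, isingSpin_sq, mul_one, hν1]
      nlinarith [hm.1, hm.2]
    · rw [sum_prod_weight_mul_mul hw1 _ _ hij, hmean, sq]
  have hexpand : ∑ y, ν y • (isingEnergy A c b y - Real.log (ν y)) =
      c * ∑ i, ∑ j, A i j * ∑ y, ν y * (isingSpin (y i) * isingSpin (y j)) +
        ∑ i : Fin n, ∑ y, ν y * (b * isingSpin (y i) - Real.log (w (y i))) := by
    have e1 : ∀ y, ν y • (isingEnergy A c b y - Real.log (ν y)) =
        c * ∑ i, ∑ j, A i j * (ν y * (isingSpin (y i) * isingSpin (y j))) +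
          ∑ i : Fin n, ν y * (b * isingSpin (y i) - Real.log (w (y i))) := by
      intro y
      have e2 : ∑ i, ∑ j, A i j * (ν y * (isingSpin (y i) * isingSpin (y j))) =
          ν y * ∑ i, ∑ j, A i j * (isingSpin (y i) * isingSpin (y j)) := by
        simp only [Finset.mul_sum]
        exact Finset.sum_congr rfl fun i _ => Finset.sum_congr rfl fun j _ => by ring
      rw [e2, hlog, isingEnergy, smul_eq_mul, ← Finset.mul_sum, Finset.sum_sub_distrib,
        ← Finset.mul_sum]
      ring
    rw [Finset.sum_congr rfl fun y _ => e1 y, Finset.sum_add_distrib, ← Finset.mul_sum,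
      Finset.sum_comm, Finset.sum_comm (t := Finset.univ (α := Fin n))
        (f := fun y i => ν y * (b * isingSpin (y i) - Real.log (w (y i))))]
    congr 2
    refine Finset.sum_congr rfl fun i _ => ?_
    rw [Finset.sum_comm]
    exact Finset.sum_congr rfl fun j _ => by rw [Finset.mul_sum]
  rw [hexpand, Finset.sum_congr rfl fun i _ =>
    sum_prod_weight_mul hw1 (fun a => b * isingSpin a - Real.log (w a)) i, hent]
  simp only [Finset.sum_const, Finset.card_univ, Fintype.card_fin, nsmul_eq_mul]
  rw [mul_assoc]
  refine add_le_add_left (mul_le_mul_of_nonneg_left ?_ hc) _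
  rw [Finset.mul_sum]
  refine Finset.sum_le_sum fun i _ => ?_
  rw [Finset.mul_sum]
  refine Finset.sum_le_sum fun j _ => ?_
  rw [mul_comm]
  exact mul_le_mul_of_nonneg_left (hcov i j) (hA i j)

/-! ### Gaussian linearization of low-rank quadratic forms -/

lemma two_mul_mul_sub_sq_eq (c t x : ℝ) :
    Real.exp (2 * c * t * x - c * x ^ 2) = Real.exp (c * t ^ 2) * Real.exp (-c * (x - t) ^ 2) := by
  rw [← Real.exp_add]
  ring_nf

lemma integrable_exp_two_mul_sub_sq {c : ℝ} (hc : 0 < c) (t : ℝ) :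
    MeasureTheory.Integrable fun x : ℝ => Real.exp (2 * c * t * x - c * x ^ 2) := by
  simp only [two_mul_mul_sub_sq_eq]
  exact ((integrable_exp_neg_mul_sq hc).comp_sub_right t).const_mul _

lemma integral_exp_two_mul_sub_sq {c : ℝ} (hc : 0 < c) (t : ℝ) :
    ∫ x : ℝ, √(c / π) * Real.exp (2 * c * t * x - c * x ^ 2) = Real.exp (c * t ^ 2) := by
  simp only [two_mul_mul_sub_sq_eq]
  rw [MeasureTheory.integral_const_mul, MeasureTheory.integral_const_mul,
    MeasureTheory.integral_sub_right_eq_self (fun x => Real.exp (-c * x ^ 2)) t,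
    integral_gaussian, mul_left_comm, ← Real.sqrt_mul (by positivity)]
  have : c / π * (π / c) = 1 := by field_simp
  rw [this, Real.sqrt_one, mul_one]

lemma sum_sq_sum_mul_orthonormal {ι κ : Type*} [Fintype ι] [DecidableEq ι] [Fintype κ]
    {v : ι → κ → ℝ} (hv : ∀ k l, ∑ i, v k i * v l i = if k = l then 1 else 0) (x : ι → ℝ) :
    ∑ i, (∑ k, x k * v k i) ^ 2 = ∑ k, x k ^ 2 := by
  calc ∑ i, (∑ k, x k * v k i) ^ 2
      = ∑ i, ∑ k, ∑ l, x k * x l * (v k i * v l i) := by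
        refine Finset.sum_congr rfl fun i _ => ?_
        rw [sq, Finset.sum_mul_sum]
        exact Finset.sum_congr rfl fun k _ => Finset.sum_congr rfl fun l _ => by ring
    _ = ∑ k, ∑ l, x k * x l * ∑ i, v k i * v l i := by
        rw [Finset.sum_comm]
        refine Finset.sum_congr rfl fun k _ => ?_
        rw [Finset.sum_comm]
        exact Finset.sum_congr rfl fun l _ => by rw [Finset.mul_sum]
    _ = ∑ k, x k ^ 2 := by simp [hv, sq]

lemma sum_exp_isingSpin_le {n : ℕ} {c γ b Γ : ℝ} (hγ : 0 < γ)
    (hΓ : ∀ s ∈ Set.Icc (-1 : ℝ) 1, meanFieldFunctional γ b s ≤ Γ) (u : Fin n → ℝ) :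
    ∑ y : Fin n → Fin 2, Real.exp (∑ i, (2 * c * u i + b) * isingSpin (y i)) ≤
      Real.exp (n * Γ + c ^ 2 / γ * ∑ i, u i ^ 2) := by
  have hsingle : ∀ i, ∑ a, Real.exp ((2 * c * u i + b) * isingSpin a) ≤
      Real.exp (Γ + c ^ 2 / γ * u i ^ 2) := by
    intro i
    obtain ⟨s, hs, hle⟩ := exists_exp_add_exp_neg_le (2 * c * u i + b)
    have h1 : 2 * c * u i * s ≤ c ^ 2 / γ * u i ^ 2 + γ * s ^ 2 := by
      have h2 : c ^ 2 / γ * u i ^ 2 + γ * s ^ 2 - 2 * c * u i * s =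
          (c * u i - γ * s) ^ 2 / γ := by field_simp; ring
      have : 0 ≤ (c * u i - γ * s) ^ 2 / γ := by positivity
      linarith
    have h3 := hΓ s hs
    unfold meanFieldFunctional at h3
    simp only [Fin.sum_univ_two, isingSpin_zero, isingSpin_one, mul_one, mul_neg]
    refine hle.trans (Real.exp_le_exp.2 ?_)
    linarith
  simp only [Real.exp_sum]
  rw [← Fintype.prod_sum (fun i a => Real.exp ((2 * c * u i + b) * isingSpin a))]
  refine (Finset.prod_le_prod (fun i _ => Finset.sum_nonneg fun a _ => (Real.exp_pos _).le)
    fun i _ => hsingle i).trans (le_of_eq ?_)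
  rw [← Real.exp_sum, Finset.sum_add_distrib, ← Finset.mul_sum]
  simp

lemma sum_exp_sq_add_le {ι : Type*} [Fintype ι] [DecidableEq ι] {n : ℕ} {v : ι → Fin n → ℝ}
    (hv : ∀ k l, ∑ i, v k i * v l i = if k = l then 1 else 0) {c γ b Γ : ℝ} (hc : 0 < c)
    (hcγ : c < γ) (hΓ : ∀ s ∈ Set.Icc (-1 : ℝ) 1, meanFieldFunctional γ b s ≤ Γ) :
    ∑ y : Fin n → Fin 2, Real.exp (c * ∑ k, (∑ i, v k i * isingSpin (y i)) ^ 2 +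
        b * ∑ i, isingSpin (y i)) ≤
      √(γ / (γ - c)) ^ Fintype.card ι * Real.exp (n * Γ) := by
  have hγ : 0 < γ := hc.trans hcγ
  set t : (Fin n → Fin 2) → ι → ℝ := fun y k => ∑ i, v k i * isingSpin (y i) with ht
  set F : (Fin n → Fin 2) → (ι → ℝ) → ℝ := fun y x =>
    Real.exp (b * ∑ i, isingSpin (y i)) *
      ∏ k, √(c / π) * Real.exp (2 * c * t y k * x k - c * x k ^ 2) with hF
  have hFint : ∀ y, MeasureTheory.Integrable (F y) := fun y =>
    (MeasureTheory.Integrable.fintype_prod fun k =>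
      (integrable_exp_two_mul_sub_sq hc (t y k)).const_mul _).const_mul _
  have hFval : ∀ y, ∫ x, F y x = Real.exp (c * ∑ k, t y k ^ 2 + b * ∑ i, isingSpin (y i)) := by
    intro y
    rw [hF, MeasureTheory.integral_const_mul,
      MeasureTheory.integral_fintype_prod_volume_eq_prod
        (fun k x => √(c / π) * Real.exp (2 * c * t y k * x - c * x ^ 2))]
    simp only [integral_exp_two_mul_sub_sq hc]
    rw [← Real.exp_sum, ← Finset.mul_sum, ← Real.exp_add, add_comm]
  have hd : 0 < c - c ^ 2 / γ := by
    have : c - c ^ 2 / γ = c * (γ - c) / γ := by field_simp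
    rw [this]
    exact div_pos (mul_pos hc (by linarith)) hγ
  set G : (ι → ℝ) → ℝ := fun x =>
    Real.exp (n * Γ) * ∏ k, √(c / π) * Real.exp (-(c - c ^ 2 / γ) * x k ^ 2) with hG
  have hGint : MeasureTheory.Integrable G :=
    (MeasureTheory.Integrable.fintype_prod fun k =>
      (integrable_exp_neg_mul_sq hd).const_mul _).const_mul _
  have hGval : ∫ x, G x = √(γ / (γ - c)) ^ Fintype.card ι * Real.exp (n * Γ) := by
    rw [hG, MeasureTheory.integral_const_mul,
      MeasureTheory.integral_fintype_prod_volume_eq_pow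
        (fun x => √(c / π) * Real.exp (-(c - c ^ 2 / γ) * x ^ 2)),
      MeasureTheory.integral_const_mul, integral_gaussian, ← Real.sqrt_mul (by positivity)]
    have h1 : γ - c ≠ 0 := by linarith
    have h2 : c / π * (π / (c - c ^ 2 / γ)) = γ / (γ - c) := by
      have : c - c ^ 2 / γ = c * (γ - c) / γ := by field_simp
      rw [this]
      field_simp
    rw [h2, mul_comm]
  have hFG : ∀ x, ∑ y, F y x ≤ G x := by
    intro x
    have h1 : ∀ y, F y x = (∏ _k : ι, √(c / π)) * Real.exp (-c * ∑ k, x k ^ 2) *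
        Real.exp (∑ i, (2 * c * (∑ k, x k * v k i) + b) * isingSpin (y i)) := by
      intro y
      rw [hF]
      simp only [Finset.prod_mul_distrib]
      rw [← Real.exp_sum, mul_left_comm, mul_assoc, ← Real.exp_add, ← Real.exp_add]
      congr 2
      rw [Finset.sum_sub_distrib, ← Finset.mul_sum]
      have h2 : ∑ k, 2 * c * t y k * x k =
          ∑ i, 2 * c * (∑ k, x k * v k i) * isingSpin (y i) := by
        simp only [ht, Finset.mul_sum, Finset.sum_mul]
        rw [Finset.sum_comm]
        exact Finset.sum_congr rfl fun i _ => Finset.sum_congr rfl fun k _ => by ring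
      simp only [add_mul, Finset.sum_add_distrib]
      rw [h2, ← Finset.mul_sum]
      ring
    rw [Finset.sum_congr rfl fun y _ => h1 y, ← Finset.mul_sum]
    refine (mul_le_mul_of_nonneg_left (sum_exp_isingSpin_le hγ hΓ _)
      (by positivity)).trans (le_of_eq ?_)
    rw [sum_sq_sum_mul_orthonormal hv, hG]
    simp only [Finset.prod_mul_distrib]
    rw [← Real.exp_sum, mul_left_comm (Real.exp _), mul_assoc, ← Real.exp_add, ← Real.exp_add,
      ← Finset.mul_sum]
    congr 2
    ring
  calc _ = ∫ x, ∑ y, F y x := by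
        rw [MeasureTheory.integral_finsetSum _ fun y _ => hFint y]
        exact Finset.sum_congr rfl fun y _ => (hFval y).symm
    _ ≤ ∫ x, G x := MeasureTheory.integral_mono
        (MeasureTheory.integrable_finsetSum _ fun y _ => hFint y) hGint hFG
    _ = _ := hGval

/-! ### Spectral estimates -/

lemma exists_orthonormal_eigenvectors {n : ℕ} {A : Matrix (Fin n) (Fin n) ℝ} (hA : A.IsSymm) :
    ∃ (lam : Fin n → ℝ) (v : Fin n → Fin n → ℝ),
      (∀ k l, ∑ i, v k i * v l i = if k = l then 1 else 0) ∧
      (∀ x y : Fin n → ℝ, ∑ k, (∑ i, v k i * x i) * (∑ i, v k i * y i) = ∑ i, x i * y i) ∧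
      ∀ k i, ∑ j, A i j * v k j = lam k * v k i := by
  have hH : A.IsHermitian := by
    rw [Matrix.IsHermitian, Matrix.conjTranspose_eq_transpose_of_trivial]
    exact hA
  refine ⟨hH.eigenvalues, fun k i => (hH.eigenvectorBasis k).ofLp i, ?_, ?_, ?_⟩
  · intro k l
    have := orthonormal_iff_ite.1 hH.eigenvectorBasis.orthonormal k l
    rw [PiLp.inner_apply] at this
    simpa [mul_comm] using this
  · intro x y
    have := hH.eigenvectorBasis.sum_inner_mul_inner (WithLp.toLp 2 x) (WithLp.toLp 2 y)
    simp only [PiLp.inner_apply, RCLike.inner_apply, conj_trivial] at this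
    simpa only [mul_comm] using this
  · intro k i
    exact congrFun (hH.mulVec_eigenvectorBasis k) i

lemma sum_sum_mul_eq_sum_eigenvalue {n : ℕ} {A : Matrix (Fin n) (Fin n) ℝ} (hA : A.IsSymm)
    {lam : Fin n → ℝ} {v : Fin n → Fin n → ℝ}
    (hv : ∀ x y : Fin n → ℝ, ∑ k, (∑ i, v k i * x i) * (∑ i, v k i * y i) = ∑ i, x i * y i)
    (hlam : ∀ k i, ∑ j, A i j * v k j = lam k * v k i) (x : Fin n → ℝ) :
    ∑ i, ∑ j, A i j * (x i * x j) = ∑ k, lam k * (∑ i, v k i * x i) ^ 2 := by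
  have h1 : ∑ i, ∑ j, A i j * (x i * x j) = ∑ i, x i * ∑ j, A i j * x j := by
    simp only [Finset.mul_sum]
    exact Finset.sum_congr rfl fun i _ => Finset.sum_congr rfl fun j _ => by ring
  rw [h1, ← hv]
  refine Finset.sum_congr rfl fun k _ => ?_
  have h2 : ∑ i, v k i * ∑ j, A i j * x j = lam k * ∑ i, v k i * x i := by
    calc ∑ i, v k i * ∑ j, A i j * x j = ∑ j, x j * ∑ i, A j i * v k i := by
          simp only [Finset.mul_sum]
          rw [Finset.sum_comm]
          refine Finset.sum_congr rfl fun j _ => Finset.sum_congr rfl fun i _ => ?_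
          rw [hA.apply j i]
          ring
      _ = _ := by
          simp only [hlam, Finset.mul_sum]
          exact Finset.sum_congr rfl fun i _ => by ring
  rw [h2]
  ring

lemma sum_eigenvalue_sq {n : ℕ} {A : Matrix (Fin n) (Fin n) ℝ}
    {lam : Fin n → ℝ} {v : Fin n → Fin n → ℝ}
    (hv₁ : ∀ k l, ∑ i, v k i * v l i = if k = l then 1 else 0)
    (hv : ∀ x y : Fin n → ℝ, ∑ k, (∑ i, v k i * x i) * (∑ i, v k i * y i) = ∑ i, x i * y i)
    (hlam : ∀ k i, ∑ j, A i j * v k j = lam k * v k i) :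
    ∑ k, lam k ^ 2 = ∑ i, ∑ j, A i j ^ 2 := by
  have h1 : ∀ k, lam k ^ 2 = ∑ i, (∑ j, A i j * v k j) ^ 2 := by
    intro k
    simp only [hlam, mul_pow, ← Finset.mul_sum]
    have := hv₁ k k
    simp only [if_true, ← sq] at this
    rw [this, mul_one]
  rw [Finset.sum_congr rfl fun k _ => h1 k, Finset.sum_comm]
  refine Finset.sum_congr rfl fun i _ => ?_
  have := hv (A i) (A i)
  simp only [← sq] at this
  rw [← this]
  exact Finset.sum_congr rfl fun k _ => by simp only [mul_comm]

lemma sum_sum_mul_le_of_row_sum_le {n : ℕ} {A : Matrix (Fin n) (Fin n) ℝ} (hA : A.IsSymm)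
    (hA0 : ∀ i j, 0 ≤ A i j) {r : ℝ} (hr : ∀ i, ∑ j, A i j ≤ r) (x : Fin n → ℝ) :
    ∑ i, ∑ j, A i j * (x i * x j) ≤ r * ∑ i, x i ^ 2 := by
  calc ∑ i, ∑ j, A i j * (x i * x j)
      ≤ ∑ i, ∑ j, (A i j * x i ^ 2 / 2 + A i j * x j ^ 2 / 2) := by
        refine Finset.sum_le_sum fun i _ => Finset.sum_le_sum fun j _ => ?_
        nlinarith [mul_nonneg (hA0 i j) (sq_nonneg (x i - x j))]
    _ = ∑ i, (∑ j, A i j) * x i ^ 2 := by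
        simp only [Finset.sum_add_distrib]
        rw [Finset.sum_comm (f := fun i j => A i j * x j ^ 2 / 2)]
        simp only [hA.apply, ← Finset.sum_add_distrib, Finset.sum_mul]
        exact Finset.sum_congr rfl fun i _ => Finset.sum_congr rfl fun j _ => by
          rw [← hA.apply i j]; ring
    _ ≤ r * ∑ i, x i ^ 2 := by
        rw [Finset.mul_sum]
        exact Finset.sum_le_sum fun i _ => mul_le_mul_of_nonneg_right (hr i) (sq_nonneg _)

/-! ### Upper bound for the partition function -/

lemma isingZ_le_of_row_sum_le {n : ℕ} {A : Matrix (Fin n) (Fin n) ℝ} (hA : A.IsSymm)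
    (hA0 : ∀ i j, 0 ≤ A i j) {r : ℝ} (hr : ∀ i, ∑ j, A i j ≤ r) {c₀ c γ b Γ ε : ℝ}
    (hc₀ : 0 ≤ c₀) (hc : 0 < c) (hrc : c₀ * r ≤ c) (hcγ : c < γ) (hε : 0 < ε)
    (hΓ : ∀ s ∈ Set.Icc (-1 : ℝ) 1, meanFieldFunctional γ b s ≤ Γ) :
    isingZ A c₀ b ≤ Real.exp (n * (Γ + c₀ * ε) +
      (∑ i, ∑ j, A i j ^ 2) / ε ^ 2 * Real.log √(γ / (γ - c))) := by
  classical
  obtain ⟨lam, v, hv₁, hv₂, hlam⟩ := exists_orthonormal_eigenvectors hA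
  have hρ : 1 ≤ √(γ / (γ - c)) := by
    rw [Real.one_le_sqrt, one_le_div (by linarith)]
    linarith
  have hlam_le : ∀ k, lam k ≤ r := by
    intro k
    have h1 := sum_sum_mul_le_of_row_sum_le hA hA0 hr (v k)
    have h2 : ∑ i, ∑ j, A i j * (v k i * v k j) = lam k * ∑ i, v k i ^ 2 := by
      rw [Finset.mul_sum]
      refine Finset.sum_congr rfl fun i _ => ?_
      rw [sq, ← mul_assoc, ← hlam, Finset.sum_mul]
      exact Finset.sum_congr rfl fun j _ => by ring
    have h3 := hv₁ k k
    simp only [if_true, ← sq] at h3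
    rwa [h2, h3, mul_one, mul_one] at h1
  have hcard : (Fintype.card {k // ε < lam k} : ℝ) ≤ (∑ i, ∑ j, A i j ^ 2) / ε ^ 2 := by
    rw [le_div_iff₀ (by positivity), ← sum_eigenvalue_sq hv₁ hv₂ hlam, Fintype.card_subtype,
      ← nsmul_eq_mul, ← Finset.sum_const]
    refine (Finset.sum_le_sum fun k hk => ?_).trans
      (Finset.sum_le_sum_of_subset_of_nonneg (Finset.filter_subset _ _)
        fun k _ _ => sq_nonneg _)
    exact pow_le_pow_left₀ hε.le (Finset.mem_filter.1 hk).2.le 2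
  have hquad : ∀ y : Fin n → Fin 2, isingEnergy A c₀ b y ≤ n * (c₀ * ε) +
      (c * ∑ k : {k // ε < lam k}, (∑ i, v k i * isingSpin (y i)) ^ 2 +
        b * ∑ i, isingSpin (y i)) := by
    intro y
    set t : Fin n → ℝ := fun k => ∑ i, v k i * isingSpin (y i) with ht
    have hparseval : ∑ k, t k ^ 2 = n := by
      have := hv₂ (fun i => isingSpin (y i)) (fun i => isingSpin (y i))
      simp only [← sq, isingSpin_sq] at this
      simpa using this
    have h1 : ∀ k, c₀ * (lam k * t k ^ 2) ≤
        c₀ * ε * t k ^ 2 + if ε < lam k then c * t k ^ 2 else 0 := by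
      intro k
      have ht0 := sq_nonneg (t k)
      split_ifs with h
      · have h2 : c₀ * lam k ≤ c := (mul_le_mul_of_nonneg_left (hlam_le k) hc₀).trans hrc
        have h3 : 0 ≤ c₀ * ε := by positivity
        nlinarith
      · have h2 : c₀ * lam k ≤ c₀ * ε := mul_le_mul_of_nonneg_left (not_lt.1 h) hc₀
        nlinarith
    have h2 : c₀ * ∑ k, lam k * t k ^ 2 ≤
        n * (c₀ * ε) + c * ∑ k : {k // ε < lam k}, t k ^ 2 := by
      rw [Finset.mul_sum]
      refine (Finset.sum_le_sum fun k _ => h1 k).trans (le_of_eq ?_)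
      rw [Finset.sum_add_distrib, ← Finset.mul_sum, hparseval, ← Finset.sum_filter,
        ← Finset.mul_sum, Finset.sum_subtype (p := fun k => ε < lam k) _ (by simp)
          (fun k => t k ^ 2)]
      ring
    unfold isingEnergy
    rw [sum_sum_mul_eq_sum_eigenvalue hA hv₂ hlam (fun i => isingSpin (y i))]
    linarith
  have hsub := sum_exp_sq_add_le (ι := {k // ε < lam k}) (v := fun k => v k)
    (fun k l => by rw [hv₁]; simp [Subtype.ext_iff]) hc hcγ hΓ
  calc isingZ A c₀ b ≤ Real.exp (n * (c₀ * ε)) *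
        (√(γ / (γ - c)) ^ Fintype.card {k // ε < lam k} * Real.exp (n * Γ)) := by
        refine le_trans ?_ (mul_le_mul_of_nonneg_left hsub (Real.exp_pos _).le)
        rw [Finset.mul_sum]
        refine Finset.sum_le_sum fun y _ => ?_
        rw [← Real.exp_add]
        exact Real.exp_le_exp.2 (hquad y)
    _ = Real.exp (n * (Γ + c₀ * ε) +
          Fintype.card {k // ε < lam k} * Real.log √(γ / (γ - c))) := by
        have hpow := Real.exp_nat_mul (Real.log √(γ / (γ - c))) (Fintype.card {k // ε < lam k})
        rw [Real.exp_log (by linarith)] at hpow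
        rw [← hpow, ← Real.exp_add, ← Real.exp_add]
        ring_nf
    _ ≤ _ := by
        refine Real.exp_le_exp.2 (add_le_add_right ?_ _)
        exact mul_le_mul_of_nonneg_right hcard (Real.log_nonneg hρ)

lemma isingZ_le {n : ℕ} {A : Matrix (Fin n) (Fin n) ℝ} (hA : A.IsSymm)
    (hA0 : ∀ i j, 0 ≤ A i j) {r : ℝ} (hr : 0 ≤ r) {c₀ c γ b Γ ε : ℝ}
    (hc₀ : 0 ≤ c₀) (hc : 0 < c) (hrc : c₀ * r ≤ c) (hcγ : c < γ) (hε : 0 < ε)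
    (hΓ : ∀ s ∈ Set.Icc (-1 : ℝ) 1, meanFieldFunctional γ b s ≤ Γ) :
    isingZ A c₀ b ≤ Real.exp (2 * c₀ * (∑ i, if ∑ j, A i j ≤ r then 0 else ∑ j, A i j) +
      (n * (Γ + c₀ * ε) + (∑ i, ∑ j, A i j ^ 2) / ε ^ 2 * Real.log √(γ / (γ - c)))) := by
  classical
  set P : Fin n → Prop := fun i => ∑ j, A i j ≤ r with hP
  set A' : Matrix (Fin n) (Fin n) ℝ :=
    Matrix.of fun i j => if P i ∧ P j then A i j else 0 with hA'
  have hA'_apply : ∀ i j, A' i j = if P i ∧ P j then A i j else 0 := fun _ _ => rfl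
  have hle : ∀ i j, A' i j ≤ A i j := by
    intro i j
    rw [hA'_apply]
    split_ifs
    · exact le_rfl
    · exact hA0 i j
  have h0 : ∀ i j, 0 ≤ A' i j := by
    intro i j
    rw [hA'_apply]
    split_ifs
    · exact hA0 i j
    · exact le_rfl
  have hsymm : A'.IsSymm := by
    refine Matrix.IsSymm.ext fun i j => ?_
    simp only [hA'_apply, hA.apply i j, and_comm]
  have hrow : ∀ i, ∑ j, A' i j ≤ r := by
    intro i
    by_cases hi : P i
    · exact (Finset.sum_le_sum fun j _ => hle i j).trans hi
    · simpa [hA'_apply, hi] using hr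
  have hρ : 1 ≤ √(γ / (γ - c)) := by
    rw [Real.one_le_sqrt, one_le_div (by linarith)]
    linarith
  have hfrob : ∑ i, ∑ j, A' i j ^ 2 ≤ ∑ i, ∑ j, A i j ^ 2 :=
    Finset.sum_le_sum fun i _ => Finset.sum_le_sum fun j _ =>
      pow_le_pow_left₀ (h0 i j) (hle i j) 2
  have hquad : ∀ y : Fin n → Fin 2, isingEnergy A c₀ b y ≤
      2 * c₀ * (∑ i, if ∑ j, A i j ≤ r then 0 else ∑ j, A i j) + isingEnergy A' c₀ b y := by
    intro y
    have h1 : ∀ i j, A i j * (isingSpin (y i) * isingSpin (y j)) ≤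
        A' i j * (isingSpin (y i) * isingSpin (y j)) +
          ((if P i then 0 else A i j) + if P j then 0 else A i j) := by
      intro i j
      have h2 : isingSpin (y i) * isingSpin (y j) ≤ 1 := by
        refine (le_abs_self _).trans ?_
        rw [abs_mul, abs_isingSpin, abs_isingSpin, mul_one]
      have h3 := mul_le_mul_of_nonneg_left h2 (hA0 i j)
      have h4 := hA0 i j
      rw [hA'_apply]
      by_cases hi : P i <;> by_cases hj : P j <;> simp [hi, hj] <;> linarith
    have h2 : ∑ i, ∑ j, (if P i then 0 else A i j) =
        ∑ i, if ∑ j, A i j ≤ r then 0 else ∑ j, A i j := by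
      refine Finset.sum_congr rfl fun i _ => ?_
      by_cases hi : P i
      · rw [if_pos (show ∑ j, A i j ≤ r from hi)]; simp [hi]
      · rw [if_neg (show ¬ ∑ j, A i j ≤ r from hi)]; simp [hi]
    have h3 : ∑ i, ∑ j, (if P j then 0 else A i j) = ∑ i, ∑ j, (if P i then 0 else A i j) := by
      rw [Finset.sum_comm]
      exact Finset.sum_congr rfl fun i _ => Finset.sum_congr rfl fun j _ => by
        rw [hA.apply]
    have h4 : ∑ i, ∑ j, A i j * (isingSpin (y i) * isingSpin (y j)) ≤
        ∑ i, ∑ j, A' i j * (isingSpin (y i) * isingSpin (y j)) +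
          2 * ∑ i, if ∑ j, A i j ≤ r then 0 else ∑ j, A i j := by
      refine (Finset.sum_le_sum fun i _ => Finset.sum_le_sum fun j _ => h1 i j).trans
        (le_of_eq ?_)
      simp only [Finset.sum_add_distrib]
      rw [h3, h2]
      ring
    unfold isingEnergy
    have := mul_le_mul_of_nonneg_left h4 hc₀
    linarith
  have hZ := isingZ_le_of_row_sum_le hsymm h0 hrow hc₀ hc hrc hcγ hε hΓ
  calc isingZ A c₀ b ≤
        Real.exp (2 * c₀ * (∑ i, if ∑ j, A i j ≤ r then 0 else ∑ j, A i j)) *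
          isingZ A' c₀ b := by
        unfold isingZ
        rw [Finset.mul_sum]
        refine Finset.sum_le_sum fun y _ => ?_
        rw [← Real.exp_add]
        exact Real.exp_le_exp.2 (hquad y)
    _ ≤ _ := mul_le_mul_of_nonneg_left hZ (Real.exp_pos _).le
    _ ≤ _ := by
        rw [← Real.exp_add]
        have := Real.log_nonneg hρ
        gcongr

lemma trace_mul_self_eq_sum_sq {n : ℕ} {A : Matrix (Fin n) (Fin n) ℝ} (hA : A.IsSymm) :
    Matrix.trace (A * A) = ∑ i, ∑ j, A i j ^ 2 := by
  simp only [Matrix.trace, Matrix.diag, Matrix.mul_apply]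
  exact Finset.sum_congr rfl fun i _ => Finset.sum_congr rfl fun j _ => by
    rw [hA.apply i j, sq]

open scoped Classical in
lemma sum_large_row_sums_le {n : ℕ} {A : Matrix (Fin n) (Fin n) ℝ}
    (hA0 : ∀ i j, 0 ≤ A i j) {η : ℝ} (hη : 0 ≤ η) :
    (∑ i, if ∑ j, A i j ≤ 1 + η then 0 else ∑ j, A i j) ≤
      (∑ i, ∑ j, A i j) - n * (1 - η) +
        (Finset.univ.filter (fun i : Fin n => η < |(∑ j, A i j) - 1|)).card := by
  have h1 : ∀ i, (if ∑ j, A i j ≤ 1 + η then 0 else ∑ j, A i j) ≤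
      (∑ j, A i j) - (1 - η) + if η < |(∑ j, A i j) - 1| then 1 else 0 := by
    intro i
    have hR : 0 ≤ ∑ j, A i j := Finset.sum_nonneg fun j _ => hA0 i j
    split_ifs with h2 h3 h3
    · linarith
    · have := (abs_le.1 (not_lt.1 h3)).1
      linarith
    · linarith
    · have := (abs_le.1 (not_lt.1 h3)).2
      exact absurd (by linarith) h2
  refine (Finset.sum_le_sum fun i _ => h1 i).trans (le_of_eq ?_)
  rw [Finset.sum_add_distrib, Finset.sum_sub_distrib, Finset.sum_boole, Finset.sum_const,
    Finset.card_univ, Fintype.card_fin, nsmul_eq_mul]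

lemma eventually_isingZ_le {A : (n : ℕ) → Matrix (Fin n) (Fin n) ℝ}
    (hsymm : ∀ n, (A n).IsSymm) (hreg : asympRegular A) {c₀ γ κ : ℝ} (hc₀ : 0 ≤ c₀)
    (hγ : c₀ < γ) (hκ : 0 < κ) :
    ∀ᶠ n : ℕ in atTop, ∀ b Γ : ℝ,
      (∀ s ∈ Set.Icc (-1 : ℝ) 1, meanFieldFunctional γ b s ≤ Γ) →
        isingZ (A n) c₀ b ≤ Real.exp (n * (Γ + κ)) := by
  obtain ⟨⟨-, htr⟩, hA0, hrow, hsum⟩ := hreg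
  obtain ⟨η, hη, hη₁, hη₂⟩ : ∃ η > 0, c₀ * (1 + η) ≤ (c₀ + γ) / 2 ∧ 6 * c₀ * η ≤ κ / 3 := by
    have hmin : 0 < min ((γ - c₀) / 2) (κ / 18) :=
      lt_min (by linarith) (by linarith)
    have h1 : c₀ * (min ((γ - c₀) / 2) (κ / 18) / (c₀ + 1)) ≤
        min ((γ - c₀) / 2) (κ / 18) := by
      rw [mul_div_assoc', div_le_iff₀ (by linarith)]
      nlinarith
    refine ⟨min ((γ - c₀) / 2) (κ / 18) / (c₀ + 1), by positivity, ?_, ?_⟩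
    · linarith [min_le_left ((γ - c₀) / 2) (κ / 18)]
    · linarith [min_le_right ((γ - c₀) / 2) (κ / 18)]
  obtain ⟨ε, hε, hε₁⟩ : ∃ ε > 0, c₀ * ε ≤ κ / 3 := by
    refine ⟨κ / 3 / (c₀ + 1), by positivity, ?_⟩
    rw [mul_div_assoc', div_le_iff₀ (by linarith)]
    nlinarith
  set L := Real.log √(γ / (γ - (c₀ + γ) / 2)) with hL
  have hL0 : 0 ≤ L := by
    refine Real.log_nonneg ?_
    rw [Real.one_le_sqrt, one_le_div (by linarith)]
    linarith
  have hζ : 0 < κ / 3 * ε ^ 2 / (L + 1) := by positivity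
  filter_upwards [htr.eventually_le_const hζ, (hrow η hη).eventually_le_const hη,
    hsum.eventually_le_const (show (1 : ℝ) < 1 + η by linarith), eventually_gt_atTop 0]
    with n htr_n hrow_n hsum_n hn b Γ hΓ
  have hn' : (0 : ℝ) < n := Nat.cast_pos.2 hn
  rw [div_le_iff₀ hn'] at htr_n hrow_n hsum_n
  rw [trace_mul_self_eq_sum_sq (hsymm n)] at htr_n
  refine (isingZ_le (hsymm n) (hA0 n) (r := 1 + η) (by linarith) hc₀ (c := (c₀ + γ) / 2)
    (by linarith) hη₁ (by linarith) hε hΓ).trans (Real.exp_le_exp.2 ?_)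
  have h1 : (∑ i, ∑ j, A n i j ^ 2) / ε ^ 2 * L ≤ κ / 3 * n := by
    rw [div_mul_eq_mul_div, div_le_iff₀ (by positivity)]
    calc (∑ i, ∑ j, A n i j ^ 2) * L ≤ κ / 3 * ε ^ 2 / (L + 1) * n * (L + 1) :=
          mul_le_mul htr_n (by linarith) hL0 (by positivity)
      _ = κ / 3 * n * ε ^ 2 := by field_simp
  have h2 := sum_large_row_sums_le (hA0 n) hη.le
  have h3 : (∑ i, if ∑ j, A n i j ≤ 1 + η then 0 else ∑ j, A n i j) ≤ 3 * η * n := by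
    linarith
  have h4 : 2 * c₀ * (∑ i, if ∑ j, A n i j ≤ 1 + η then 0 else ∑ j, A n i j) ≤ κ / 3 * n := by
    have := mul_le_mul_of_nonneg_left h3 (show 0 ≤ 2 * c₀ by linarith)
    have := mul_le_mul_of_nonneg_right hη₂ hn'.le
    linarith
  have h5 := mul_le_mul_of_nonneg_right hε₁ hn'.le
  linarith

lemma eventually_le_isingZ {A : (n : ℕ) → Matrix (Fin n) (Fin n) ℝ}
    (hreg : asympRegular A) {c b m κ : ℝ} (hc : 0 ≤ c) (hm : m ∈ Set.Ioo (-1 : ℝ) 1)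
    (hκ : 0 < κ) :
    ∀ᶠ n : ℕ in atTop,
      Real.exp (n * (meanFieldFunctional c b m - κ)) ≤ isingZ (A n) c b := by
  obtain ⟨-, hA0, -, hsum⟩ := hreg
  have hlim := (hsum.const_mul (c * m ^ 2)).eventually_const_le
    (show c * m ^ 2 - κ < c * m ^ 2 * 1 by linarith)
  filter_upwards [hlim, eventually_gt_atTop 0] with n hn hn0
  refine le_trans (Real.exp_le_exp.2 ?_) (exp_meanField_le_isingZ (hA0 n) hc hm)
  rw [mul_div_assoc', le_div_iff₀ (Nat.cast_pos.2 hn0)] at hn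
  unfold meanFieldFunctional
  linarith

/-! ### Concentration -/

lemma natCast_mul_avgMagnet {n : ℕ} (hn : 0 < n) (y : Fin n → Fin 2) :
    n * avgMagnet y = ∑ i, isingSpin (y i) := by
  have : (n : ℝ) ≠ 0 := Nat.cast_ne_zero.2 hn.ne'
  unfold avgMagnet isingSpin
  field_simp

/-- Exponential Chebyshev bound for the magnetization. -/
lemma sum_exp_isingEnergy_le_of_notMem_Icc {n : ℕ} (hn : 0 < n) (A : Matrix (Fin n) (Fin n) ℝ)
    (c b : ℝ) {m δ t : ℝ} (ht : 0 < t) {S : Finset (Fin n → Fin 2)}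
    (hS : ∀ y ∈ S, avgMagnet y ∉ Set.Icc (m - δ) (m + δ)) :
    ∑ y ∈ S, Real.exp (isingEnergy A c b y) ≤
      isingZ A c (b + t) * Real.exp (-(n * (t * (m + δ)))) +
        isingZ A c (b + -t) * Real.exp (n * (t * (m - δ))) := by
  have hn' : (0 : ℝ) < n := Nat.cast_pos.2 hn
  have hpt : ∀ y ∈ S,
      Real.exp (isingEnergy A c b y) ≤
        Real.exp (isingEnergy A c (b + t) y) * Real.exp (-(n * (t * (m + δ)))) +
          Real.exp (isingEnergy A c (b + -t) y) * Real.exp (n * (t * (m - δ))) := by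
    intro y hy
    have hshift : ∀ τ, isingEnergy A c (b + τ) y =
        isingEnergy A c b y + τ * (n * avgMagnet y) := by
      intro τ
      rw [natCast_mul_avgMagnet hn]
      unfold isingEnergy
      ring
    have hy' : avgMagnet y < m - δ ∨ m + δ < avgMagnet y := by
      by_contra hcon
      rw [not_or, not_lt, not_lt] at hcon
      exact hS y hy hcon
    rw [hshift, hshift, ← Real.exp_add, ← Real.exp_add]
    have hnt : 0 < n * t := mul_pos hn' ht
    rcases hy' with h | h
    · refine le_add_of_nonneg_of_le (Real.exp_pos _).le (Real.exp_le_exp.2 ?_)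
      nlinarith
    · refine le_add_of_le_of_nonneg (Real.exp_le_exp.2 ?_) (Real.exp_pos _).le
      nlinarith
  unfold isingZ
  rw [Finset.sum_mul, Finset.sum_mul, ← Finset.sum_add_distrib]
  refine (Finset.sum_le_sum fun y hy => hpt y hy).trans ?_
  exact Finset.sum_le_sum_of_subset_of_nonneg (Finset.subset_univ _)
    fun y _ _ => by positivity

theorem ising_concentration_external_field
    (A : (n : ℕ) → Matrix (Fin n) (Fin n) ℝ) (hsymm : ∀ n, (A n).IsSymm)
    (hreg : asympRegular A) (β : ℝ) (hβ : 0 ≤ β)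
    (h : Fin 2 → ℝ) (hB : h 0 - h 1 ≠ 0)
    (m : ℝ) (hm : m ∈ Set.Ioo (-1 : ℝ) 1)
    (hfix : m = Real.tanh ((β / 2) * m + (h 0 - h 1) / 2))
    (hsign : 0 < m * (h 0 - h 1))
    (δ : ℝ) (hδ : 0 < δ) :
    ∃ ε : ℝ, 0 < ε ∧ ∀ᶠ n : ℕ in atTop,
      1 - Real.exp (-(n : ℝ) * ε) ≤
        pottsMass (A n) (β • (1 : Matrix (Fin 2) (Fin 2) ℝ)) h
          {y | avgMagnet y ∈ Set.Icc (m - δ) (m + δ)} := by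
  have hc : 0 ≤ β / 4 := by positivity
  have hmb : 0 < m * ((h 0 - h 1) / 2) := by linarith
  have hfix' : m = Real.tanh (2 * (β / 4) * m + (h 0 - h 1) / 2) := by
    rw [show 2 * (β / 4) * m = β / 2 * m by ring]
    exact hfix
  obtain ⟨t, ht, γ, hγ, hpert⟩ := exists_meanFieldFunctional_perturbation hδ
    (fun s hs hsm => meanFieldFunctional_lt hmb hm hfix' hs hsm) hm
  set b := (h 0 - h 1) / 2 with hb
  set M := meanFieldFunctional (β / 4) b m with hM
  have hκ : 0 < t * δ / 8 := by positivity
  refine ⟨t * δ / 8, hκ, ?_⟩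
  filter_upwards [eventually_isingZ_le hsymm hreg hc hγ hκ,
    eventually_le_isingZ hreg (b := b) hc hm hκ, eventually_gt_atTop 0,
    tendsto_natCast_atTop_atTop.eventually_ge_atTop (1 / (t * δ / 8))]
    with n hup hlow hn hlarge
  rw [pottsMass_eq_ising, ← hb]
  refine sub_le_sub_left ?_ 1
  rw [div_le_iff₀ (isingZ_pos _ _ _)]
  have h1 := hup (b + t) _ (hpert t (abs_of_pos ht))
  have h2 := hup (b + -t) _ (hpert (-t) (by rw [abs_neg, abs_of_pos ht]))
  have h3 : (2 : ℝ) ≤ Real.exp (n * (t * δ / 8)) := by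
    rw [div_le_iff₀ hκ] at hlarge
    linarith [Real.add_one_le_exp (n * (t * δ / 8))]
  refine (sum_exp_isingEnergy_le_of_notMem_Icc hn (A n) (β / 4) b (m := m) (δ := δ) ht ?_).trans ?_
  · intro y hy
    simpa using hy
  calc _ ≤ Real.exp (n * (M + t * m + t * (δ / 2) + t * δ / 8)) *
          Real.exp (-(n * (t * (m + δ)))) +
        Real.exp (n * (M + -t * m + t * (δ / 2) + t * δ / 8)) *
          Real.exp (n * (t * (m - δ))) := by gcongr
    _ = 2 * Real.exp (n * (M - 3 * (t * δ / 8))) := by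
        rw [← Real.exp_add, ← Real.exp_add, two_mul]
        ring_nf
    _ ≤ Real.exp (n * (t * δ / 8)) * Real.exp (n * (M - 3 * (t * δ / 8))) := by gcongr
    _ = Real.exp (-n * (t * δ / 8)) * Real.exp (n * (M - t * δ / 8)) := by
        rw [← Real.exp_add, ← Real.exp_add]
        ring_nf
    _ ≤ _ := mul_le_mul_of_nonneg_left hlow (Real.exp_pos _).le
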